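/- For any nonzero ξ, η ∈ ℝ^3 and j ∈ {1,2,3}, the symbol q_{0j}(ξ,η) = -⟨ξ⟩η_j + ξ_j⟨η⟩ satisfies |q_{0j}(ξ,η)| ≲ |ξ||η| θ(ξ,η) + |ξ|/⟨η⟩ + |η|/⟨ξ⟩, where θ(ξ,η) is the angle between ξ and η and ⟨ξ⟩ = (1+|ξ|²)^{1/2}. -/

import Mathlib

/- STATEMENT 8: |q_{0j}(ξ,η)| = |-⟨ξ⟩η_j + ξ_j⟨η⟩| ≲ |ξ||η|θ(ξ,η) + |ξ|/⟨η⟩ + |η|/⟨ξ⟩ for nonzero ξ,η ∈ ℝ³. -/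

noncomputable section

open InnerProductGeometry

/-- ℝ³ as a Euclidean space. -/
abbrev E3 : Type := EuclideanSpace ℝ (Fin 3)

/-- The Japanese bracket ⟨ξ⟩ = (1+|ξ|²)^{1/2}. -/
def jb (ξ : E3) : ℝ := Real.sqrt (1 + ‖ξ‖ ^ 2)

/-- Rescaling two vectors to the same length, their distance is at most that length times the
angle between them. -/
theorem norm_norm_smul_sub_norm_smul_le {V : Type*} [NormedAddCommGroup V]
    [InnerProductSpace ℝ V] (x y : V) :
    ‖‖y‖ • x - ‖x‖ • y‖ ≤ ‖x‖ * ‖y‖ * angle x y := by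
  have hnn : 0 ≤ ‖x‖ * ‖y‖ * angle x y := by
    have := angle_nonneg x y
    positivity
  refine le_of_sq_le_sq ?_ hnn
  have hcos := Real.one_sub_sq_div_two_le_cos (x := angle x y)
  have hinner := cos_angle_mul_norm_mul_norm x y
  rw [norm_sub_sq_real, real_inner_smul_left, real_inner_smul_right, norm_smul, norm_smul,
    norm_norm, norm_norm, ← hinner]
  nlinarith [mul_le_mul_of_nonneg_left hcos (sq_nonneg (‖x‖ * ‖y‖))]

theorem jb_pos (ξ : E3) : 0 < jb ξ :=
  Real.sqrt_pos.2 (by positivity)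

theorem norm_le_jb (ξ : E3) : ‖ξ‖ ≤ jb ξ :=
  Real.le_sqrt_of_sq_le (by linarith)

theorem jb_sub_norm_le (ξ : E3) : jb ξ - ‖ξ‖ ≤ 1 / jb ξ := by
  have hsq : jb ξ ^ 2 = 1 + ‖ξ‖ ^ 2 := Real.sq_sqrt (by positivity)
  rw [le_div_iff₀ (jb_pos ξ)]
  nlinarith [norm_le_jb ξ, norm_nonneg ξ]

/-- Replacing the bracket by the norm in `⟨ξ⟩ η` costs at most `|η| / ⟨ξ⟩` in each coordinate. -/
theorem abs_jb_sub_norm_mul_le (ξ η : E3) (j : Fin 3) :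
    |(jb ξ - ‖ξ‖) * η j| ≤ ‖η‖ / jb ξ := by
  rw [abs_mul, abs_of_nonneg (sub_nonneg.2 (norm_le_jb ξ)), div_eq_inv_mul, ← one_div]
  have hcoord : |η j| ≤ ‖η‖ := PiLp.norm_apply_le η j
  have := jb_pos ξ
  exact mul_le_mul (jb_sub_norm_le ξ) hcoord (abs_nonneg _) (by positivity)

theorem q0j_symbol_estimate :
    ∃ C : ℝ, 0 < C ∧ ∀ ξ η : E3, ξ ≠ 0 → η ≠ 0 → ∀ j : Fin 3,
      |(-(jb ξ) * η j + ξ j * jb η)| ≤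
        C * (‖ξ‖ * ‖η‖ * angle ξ η + ‖ξ‖ / jb η + ‖η‖ / jb ξ) := by
  refine ⟨1, one_pos, fun ξ η _ _ j ↦ ?_⟩
  have hangle : |‖η‖ * ξ j - ‖ξ‖ * η j| ≤ ‖ξ‖ * ‖η‖ * angle ξ η :=
    (PiLp.norm_apply_le (‖η‖ • ξ - ‖ξ‖ • η) j).trans (norm_norm_smul_sub_norm_smul_le ξ η)
  have hξ := abs_jb_sub_norm_mul_le η ξ j
  have hη := abs_jb_sub_norm_mul_le ξ η j
  rw [abs_le] at *
  constructor <;> linarith
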